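/- Let Λ = (W_j, Λ_j, v_j) be a g-fusion frame for H with canonical dual ~Λ = (~W_j, ~Λ_j, v_j), where ~W_j = S_Λ^{-1} W_j and ~Λ_j = Λ_j π_{W_j} S_Λ^{-1}, and let j₀ ∈ J with v_{j₀} = 1. If there exists g₀ ∈ H_{j₀} with g₀ ≠ 0 such that ~Λ_{j₀} π_{~W_{j₀}} π_{W_{j₀}} Λ_{j₀}* g₀ = g₀, then the family (W_j, Λ_j)_{j ≠ j₀} is not gf-complete in H. -/

import Mathlib

noncomputable section

open ContinuousLinearMap Submodule Set

variable {H : Type*} [NormedAddCommGroup H] [InnerProductSpace ℂ H] [CompleteSpace H]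

/-- The orthogonal projection onto a (complete, i.e. closed) subspace `K` of `H`,
viewed as a continuous endomorphism of `H`. -/
def gfP (K : Submodule ℂ H) [CompleteSpace K] : H →L[ℂ] H :=
  K.subtypeL.comp (orthogonalProjection K)

/-- The orthogonal projection onto the topological closure of a subspace `K` of `H`. -/
def gfPc (K : Submodule ℂ H) : H →L[ℂ] H :=
  haveI : CompleteSpace K.topologicalClosure :=
    K.isClosed_topologicalClosure.completeSpace_coe
  (K.topologicalClosure).subtypeL.comp (orthogonalProjection K.topologicalClosure)

theorem inner_gfP_left (K : Submodule ℂ H) [CompleteSpace K] (x y : H) :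
    inner ℂ (gfP K x) y = inner ℂ x (gfP K y) :=
  K.inner_starProjection_left_eq_right x y

theorem inner_gfPc_of_mem {K : Submodule ℂ H} {w : H} (hw : w ∈ K) (x : H) :
    inner ℂ w (gfPc K x) = inner ℂ w x := by
  have : CompleteSpace K.topologicalClosure :=
    K.isClosed_topologicalClosure.completeSpace_coe
  change inner ℂ w (K.topologicalClosure.starProjection x) = _
  rw [← K.topologicalClosure.inner_starProjection_left_eq_right,
    Submodule.starProjection_eq_self_iff.mpr (K.le_topologicalClosure hw)]

theorem inner_gfP_adjoint {F : Type*} [NormedAddCommGroup F] [InnerProductSpace ℂ F]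
    [CompleteSpace F] (K : Submodule ℂ H) [CompleteSpace K] (L : H →L[ℂ] F) (f : H) (x : F) :
    inner ℂ f (gfP K (ContinuousLinearMap.adjoint L x)) = inner ℂ (L (gfP K f)) x := by
  rw [← inner_gfP_left, ContinuousLinearMap.adjoint_inner_right]

/-- If `R` is symmetric, then `π_K R π_{closure (R K)} = π_K R`. -/
theorem gfP_comp_gfPc_map (K : Submodule ℂ H) [CompleteSpace K] (R : H →L[ℂ] H)
    (hR : ∀ x y, inner ℂ (R x) y = inner ℂ x (R y)) (x : H) :
    gfP K (R (gfPc (K.map (R : H →ₗ[ℂ] H)) x)) = gfP K (R x) := by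
  refine ext_inner_left ℂ fun y => ?_
  have hmem : R (gfP K y) ∈ K.map (R : H →ₗ[ℂ] H) :=
    Submodule.mem_map_of_mem (K.starProjection_apply_mem y)
  rw [← inner_gfP_left, ← inner_gfP_left, ← hR, ← hR, inner_gfPc_of_mem hmem]

/-- Let `(W j, Λ j, v j)` be a g-fusion frame for `H` with canonical dual
`(W̃ j, Λ̃ j, v j)` (`W̃ j = S⁻¹ W j`, `Λ̃ j = Λ j ∘ π_{W j} ∘ S⁻¹`), let `j₀ ∈ J` with
`v j₀ = 1`. If some `g₀ ∈ H_{j₀}`, `g₀ ≠ 0`, satisfies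
`Λ̃ j₀ (π_{W̃ j₀} (π_{W j₀} ((Λ j₀)* g₀))) = g₀`, then `(W j, Λ j)_{j ≠ j₀}` is not
gf-complete in `H`. -/
theorem stmt14 {ι : Type*} [Countable ι] {G : ι → Type*}
    [∀ j, NormedAddCommGroup (G j)] [∀ j, InnerProductSpace ℂ (G j)] [∀ j, CompleteSpace (G j)]
    (W : ι → Submodule ℂ H) [∀ j, CompleteSpace (W j)]
    (Λ : ∀ j, H →L[ℂ] G j) (v : ι → ℝ) (hv : ∀ j, 0 < v j)
    (A B : ℝ) (hA : 0 < A) (hAB : A ≤ B)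
    (hframe : ∀ f : H, Summable (fun j => (v j) ^ 2 * ‖Λ j (gfP (W j) f)‖ ^ 2) ∧
      A * ‖f‖ ^ 2 ≤ ∑' j, (v j) ^ 2 * ‖Λ j (gfP (W j) f)‖ ^ 2 ∧
      ∑' j, (v j) ^ 2 * ‖Λ j (gfP (W j) f)‖ ^ 2 ≤ B * ‖f‖ ^ 2)
    (S Sinv : H →L[ℂ] H)
    (hS : ∀ f : H,
      HasSum (fun j =>
        (v j) ^ 2 • gfP (W j) (ContinuousLinearMap.adjoint (Λ j) (Λ j (gfP (W j) f)))) (S f))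
    (hS1 : ∀ f : H, S (Sinv f) = f) (hS2 : ∀ f : H, Sinv (S f) = f)
    (Λd : ∀ j, H →L[ℂ] G j) (hΛd : ∀ j, Λd j = ((Λ j).comp (gfP (W j))).comp Sinv)
    (j₀ : ι) (hv₀ : v j₀ = 1) (g₀ : G j₀) (hg₀ : g₀ ≠ 0)
    (h : Λd j₀ (gfPc ((W j₀).map (Sinv : H →ₗ[ℂ] H))
      (gfP (W j₀) (ContinuousLinearMap.adjoint (Λ j₀) g₀))) = g₀) :
    ¬ ((Submodule.span ℂ
        (⋃ j, ⋃ _ : j ≠ j₀, Set.range fun x : G j =>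
          gfP (W j) (ContinuousLinearMap.adjoint (Λ j) x))).topologicalClosure = ⊤) := by
  have hSinner : ∀ f g : H, HasSum
      (fun j => ((v j : ℂ) ^ 2) * inner ℂ (Λ j (gfP (W j) g)) (Λ j (gfP (W j) f)))
      (inner ℂ g (S f)) := by
    intro f g
    have h1 := (hS f).mapL (innerSL ℂ g)
    simpa only [innerSL_apply_apply, inner_smul_right_eq_smul, inner_gfP_adjoint, Complex.real_smul,
      Complex.ofReal_pow] using h1
  have hSsymm : ∀ f g : H, inner ℂ (S f) g = inner ℂ f (S g) := by
    intro f g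
    have h1 := (hSinner f g).map (starRingEnd ℂ) Complex.continuous_conj
    rw [inner_conj_symm] at h1
    refine h1.unique ?_
    convert hSinner g f using 2 with j
    simp
  have hRsymm : ∀ x y : H, inner ℂ (Sinv x) y = inner ℂ x (Sinv y) := by
    intro x y
    conv_lhs => rw [← hS1 y]
    rw [← hSsymm, hS1]
  set f : H := Sinv (gfP (W j₀) (ContinuousLinearMap.adjoint (Λ j₀) g₀)) with hf
  have hTf : Λ j₀ (gfP (W j₀) f) = g₀ := by
    rw [hΛd] at h
    simp only [ContinuousLinearMap.comp_apply] at h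
    rwa [gfP_comp_gfPc_map _ _ hRsymm] at h
  have hsum : HasSum (fun j => (v j) ^ 2 * ‖Λ j (gfP (W j) f)‖ ^ 2) (‖g₀‖ ^ 2) := by
    have h1 := hSinner f f
    rw [hf, hS1, ← hf, inner_gfP_adjoint, hTf] at h1
    simp only [inner_self_eq_norm_sq_to_K] at h1
    refine Complex.hasSum_ofReal.mp ?_
    push_cast
    exact h1
  have hzero : ∀ j, j ≠ j₀ → Λ j (gfP (W j) f) = 0 := by
    intro j hj
    classical
    have h1 := sum_le_hasSum ({j, j₀} : Finset ι) (fun i _ => by positivity) hsum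
    rw [Finset.sum_pair hj, hTf, hv₀, one_pow, one_mul] at h1
    have h2 : (v j) ^ 2 * ‖Λ j (gfP (W j) f)‖ ^ 2 ≤ 0 := by linarith
    have h3 := hv j
    by_contra hne
    have h4 := norm_pos_iff.mpr hne
    exact absurd h2 (not_le.mpr (by positivity))
  intro htop
  have hfperp : f ∈ (Submodule.span ℂ
        (⋃ j, ⋃ _ : j ≠ j₀, Set.range fun x : G j =>
          gfP (W j) (ContinuousLinearMap.adjoint (Λ j) x)))ᗮ := by
    rw [Submodule.mem_orthogonal']
    intro u hu
    induction hu using Submodule.span_induction with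
    | mem u hu =>
      simp only [Set.mem_iUnion, Set.mem_range] at hu
      obtain ⟨j, hj, x, rfl⟩ := hu
      rw [inner_gfP_adjoint, hzero j hj, inner_zero_left]
    | zero => exact inner_zero_right _
    | add u w _ _ hu hw => rw [inner_add_right, hu, hw, add_zero]
    | smul c u _ hu => rw [inner_smul_right, hu, mul_zero]
  rw [Submodule.topologicalClosure_eq_top_iff.mp htop, Submodule.mem_bot] at hfperp
  rw [hfperp, map_zero, map_zero] at hTf
  exact hg₀ hTf.symm
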